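/- For all real x, t and y > 0, the sum over all integers k of y / ((x - t - 2k)^2 + y^2) equals (π/2) · sinh(πy) / (cosh(πy) − cos(π(x−t))). -/

import Mathlib

open Real

lemma ppk_term (s y : ℝ) (hy : 0 < y) (k : ℝ) :
    y / ((s - 2 * k) ^ 2 + y ^ 2) =
      -(1 / 2) * (1 / (((⟨s / 2, y / 2⟩ : ℂ)) - (k : ℂ))).im := by
  have h1 : (s - 2 * k) ^ 2 + y ^ 2 ≠ 0 := by positivity
  have h2 : (s / 2 - k) * (s / 2 - k) + y / 2 * (y / 2) ≠ 0 := by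
    intro h; apply h1; linarith
  rw [one_div (_ : ℂ), Complex.inv_im, Complex.normSq_apply]
  simp only [Complex.sub_re, Complex.sub_im, Complex.ofReal_re, Complex.ofReal_im, sub_zero]
  rw [show (s / 2 - k) * (s / 2 - k) + y / 2 * (y / 2) = ((s - 2 * k) ^ 2 + y ^ 2) / 4 by ring]
  field_simp
  norm_num

lemma ppk_cot (a b : ℝ) (hb : 0 < b) :
    (Complex.cot (⟨a, b⟩ : ℂ)).im =
      -(Real.sinh (2 * b) / (Real.cosh (2 * b) - Real.cos (2 * a))) := by
  have hz : (⟨a, b⟩ : ℂ) = (a : ℂ) + (b : ℂ) * Complex.I := Complex.mk_eq_add_mul_I a b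
  have hs : 0 < Real.sinh b := Real.sinh_pos_iff.2 hb
  have hc := Real.cosh_sq b
  have ht := Real.sin_sq_add_cos_sq a
  have hD : Real.cosh (2 * b) - Real.cos (2 * a)
      = 2 * (Real.sinh b ^ 2 + Real.sin a ^ 2) := by
    rw [Real.cosh_two_mul, Real.cos_two_mul]; nlinarith
  have hN : Complex.normSq (Complex.sin (⟨a, b⟩ : ℂ)) = Real.sinh b ^ 2 + Real.sin a ^ 2 := by
    rw [hz, Complex.sin_add_mul_I, ← Complex.ofReal_sin, ← Complex.ofReal_cos,
      ← Complex.ofReal_sinh, ← Complex.ofReal_cosh, ← Complex.ofReal_mul, ← Complex.ofReal_mul,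
      Complex.normSq_add_mul_I]
    rw [mul_pow, mul_pow, hc, Real.cos_sq']; ring
  have hP : Real.sinh b ^ 2 + Real.sin a ^ 2 ≠ 0 := by positivity
  rw [Complex.cot, Complex.div_im, hN, hD, hz, Complex.sin_add_mul_I, Complex.cos_add_mul_I,
    ← Complex.ofReal_sin, ← Complex.ofReal_cos,
      ← Complex.ofReal_sinh, ← Complex.ofReal_cosh, Real.sinh_two_mul]
  simp only [Complex.add_re, Complex.add_im, Complex.sub_re, Complex.sub_im, Complex.mul_re,
    Complex.mul_im, Complex.ofReal_re, Complex.ofReal_im, Complex.I_re, Complex.I_im]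
  field_simp
  linear_combination (-Real.cosh b * Real.sinh b) * ht

theorem periodized_poisson_kernel (x t y : ℝ) (hy : 0 < y) :
    ∑' k : ℤ, y / ((x - t - 2 * (k : ℝ)) ^ 2 + y ^ 2) =
      (π / 2) * Real.sinh (π * y) / (Real.cosh (π * y) - Real.cos (π * (x - t))) := by
  generalize x - t = s
  set f : ℤ → ℝ := fun k => y / ((s - 2 * (k : ℝ)) ^ 2 + y ^ 2) with hf
  set z : ℂ := ⟨s / 2, y / 2⟩ with hzdef
  have hz : z ∈ Complex.integerComplement :=
    UpperHalfPlane.coe_mem_integerComplement ⟨z, by simp [hzdef, hy]⟩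
  have hsum := (summable_cotTerm hz).hasSum
  have hcot : ∑' n : ℕ, cotTerm z n = π * Complex.cot (π * z) - 1 / z := (cot_series_rep' hz).symm
  rw [hcot] at hsum
  have him := (Complex.hasSum_im hsum).mul_left (-(1 / 2))
  have hpair : ∀ n : ℕ, -(1 / 2) * (cotTerm z n).im = f (n + 1) + f (-(n + 1)) := by
    intro n
    have h1 := ppk_term s y hy (n + 1)
    have h2 := ppk_term s y hy (-(n + 1))
    simp only [hf, cotTerm]
    push_cast at h1 h2 ⊢
    rw [h1, h2, Complex.add_im, sub_neg_eq_add]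
    ring
  simp only [hpair] at him
  have hnn : ∀ k, 0 ≤ f k := fun k => by simp only [hf]; positivity
  have s1 : Summable fun n : ℕ => f (n + 1) :=
    him.summable.of_nonneg_of_le (fun n => hnn _) (fun n => by linarith [hnn (-(n + 1))])
  have s2 : Summable fun n : ℕ => f (-(n + 1)) :=
    him.summable.of_nonneg_of_le (fun n => hnn _) (fun n => by linarith [hnn (n + 1)])
  have key := tsum_of_add_one_of_neg_add_one s1 s2
  have hadd := s1.tsum_add s2
  rw [him.tsum_eq] at hadd
  have h0 : f 0 = -(1 / 2) * (1 / z).im := by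
    have := ppk_term s y hy 0
    rw [Complex.ofReal_zero, sub_zero] at this
    simp only [hf]
    rw [Int.cast_zero]
    exact this
  have hpz : (π : ℂ) * z = ⟨π * s / 2, π * y / 2⟩ := by
    apply Complex.ext <;> simp [hzdef] <;> ring
  have hc := ppk_cot (π * s / 2) (π * y / 2) (by positivity)
  rw [hpz, Complex.sub_im, Complex.im_ofReal_mul, hc] at hadd
  rw [mul_div_cancel₀ _ two_ne_zero] at hadd
  rw [show 2 * (π * s / 2) = π * s by ring] at hadd
  rw [mul_div_assoc]
  linarith
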